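/- arXiv:0903.2567 — 2 statements merged into one kernel-verified Lean document; each statement's English description precedes it below -/
import Mathlib

section
/- Every Boolean metric space X over a Boolean ring B is isometric to a metrizable subset of some B-module equipped with its modular metric. Moreover, for any fixed x₀ ∈ X there exist a B-module M and an injective map g : X → M such that g(x₀) = 0 and, for all x,y ∈ X and all b ∈ B, b·(g(x) − g(y)) = 0 if and only if b·d(x,y) = 0 (i.e., Ann(g(x)−g(y)) is the principal ideal of B generated by d(x,y)+1, so g(X) is metrizable and g is an isometry onto g(X) with its modular metric). -/
/-- The order on a Boolean ring: `a ≤ b` iff `a * b = a`. -/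
def ble {B : Type} [BooleanRing B] (a b : B) : Prop := a * b = a

/-- The join on a Boolean ring: `a ∨ b = a + b + a * b`. -/
def bjoin {B : Type} [BooleanRing B] (a b : B) : B := a + b + a * b

/-- A Boolean metric space over a Boolean ring `B`: `d x y = 0` iff `x = y`,
`d` is symmetric, and `d x z ≤ d x y ∨ d y z`. -/
structure BooleanMetric (B : Type) [BooleanRing B] (X : Type) where
  d : X → X → B
  d_eq_zero : ∀ x y, d x y = 0 ↔ x = y
  d_symm : ∀ x y, d x y = d y x
  d_tri : ∀ x y z, ble (d x z) (bjoin (d x y) (d y z))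

/-- The coefficients `a i` have pairwise zero products. -/
def PairwiseOrthCoeffs {B : Type} [BooleanRing B] {k : ℕ} (a : Fin k → B) : Prop :=
  ∀ i j, i ≠ j → a i * a j = 0

/-- `x` is a convex combination of `x₁, …, xₖ` with coefficients `a₁, …, aₖ`,
i.e. `aᵢ · d(x, xᵢ) = 0` for all `i`. -/
def IsConvComb {B X : Type} [BooleanRing B] (m : BooleanMetric B X) {k : ℕ}
    (a : Fin k → B) (xs : Fin k → X) (x : X) : Prop :=
  ∀ i, a i * m.d x (xs i) = 0

/-- A subset `S` is convex: every convex combination of points of `S` (with pairwise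
disjoint coefficients summing to `1`) exists in `S`. -/
def IsConvexSubspace {B X : Type} [BooleanRing B] (m : BooleanMetric B X) (S : Set X) : Prop :=
  ∀ (k : ℕ) (a : Fin k → B) (xs : Fin k → X), (∀ i, xs i ∈ S) →
    PairwiseOrthCoeffs a → (∑ i, a i) = 1 → ∃ x ∈ S, IsConvComb m a xs x

/-- A subset `S` is a CFG-space: it is convex and there are finitely many points of `S`
of which every point of `S` is a convex combination. -/
def IsCFGSubspace {B X : Type} [BooleanRing B] (m : BooleanMetric B X) (S : Set X) : Prop :=
  IsConvexSubspace m S ∧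
  ∃ (k : ℕ) (xs : Fin k → X), (∀ i, xs i ∈ S) ∧
    ∀ x ∈ S, ∃ a : Fin k → B, PairwiseOrthCoeffs a ∧ (∑ i, a i) = 1 ∧ IsConvComb m a xs x

/-- A contractive map: `d(f x, f y) ≤ d(x, y)`. -/
def Contractive {B X Y : Type} [BooleanRing B] (mX : BooleanMetric B X) (mY : BooleanMetric B Y)
    (f : X → Y) : Prop :=
  ∀ x y, ble (mY.d (f x) (f y)) (mX.d x y)

/-- `sm a x` is the convex combination `a x + (a+1) 0` of `x` and the base point `z`
with coefficients `a` and `a + 1`. -/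
def IsScalarMul {B X : Type} [BooleanRing B] (m : BooleanMetric B X) (z : X)
    (sm : B → X → X) : Prop :=
  ∀ a x, a * m.d (sm a x) x = 0 ∧ (a + 1) * m.d (sm a x) z = 0

/-- `x ⊥ y`, i.e. `x ⋆ y = (d(x,y)+1) x = 0`. -/
def Orth {B X : Type} [BooleanRing B] (m : BooleanMetric B X) (z : X) (sm : B → X → X)
    (x y : X) : Prop :=
  sm (m.d x y + 1) x = z

/-- `x` is the convex combination of `0, x₁, …, xₖ` with coefficients
`a₀ = 1 + a₁ + ⋯ + aₖ, a₁, …, aₖ`. -/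
def ConvCombWithZero {B X : Type} [BooleanRing B] (m : BooleanMetric B X) (z : X) {k : ℕ}
    (a : Fin k → B) (xs : Fin k → X) (x : X) : Prop :=
  PairwiseOrthCoeffs a ∧ (∀ i, a i * m.d x (xs i) = 0) ∧ (1 + ∑ i, a i) * m.d x z = 0

/-- `x₁, …, xₖ` is a referential of `(X, z)`: the `xᵢ` are nonzero, pairwise orthogonal,
and every point of `X` is a convex combination of `0, x₁, …, xₖ`. -/
def IsReferential {B X : Type} [BooleanRing B] (m : BooleanMetric B X) (z : X)
    (sm : B → X → X) {k : ℕ} (xs : Fin k → X) : Prop :=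
  (∀ i, xs i ≠ z) ∧ (∀ i j, i ≠ j → Orth m z sm (xs i) (xs j)) ∧
  ∀ x : X, ∃ a : Fin k → B, ConvCombWithZero m z a xs x

/-- The whole space is a convex closure of the subset `S`: it is convex and every point
is a convex combination of points of `S`. -/
def IsConvexClosure {B X : Type} [BooleanRing B] (m : BooleanMetric B X) (S : Set X) : Prop :=
  IsConvexSubspace m Set.univ ∧
  ∀ x : X, ∃ (k : ℕ) (a : Fin k → B) (xs : Fin k → X),
    (∀ i, xs i ∈ S) ∧ PairwiseOrthCoeffs a ∧ (∑ i, a i) = 1 ∧ IsConvComb m a xs x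

/-- A finite set `R` is a referential of `(X, z)` (set version). -/
def IsReferentialSet {B X : Type} [BooleanRing B] (m : BooleanMetric B X) (z : X)
    (sm : B → X → X) (R : Finset X) : Prop :=
  z ∉ R ∧ (∀ x ∈ R, ∀ y ∈ R, x ≠ y → Orth m z sm x y) ∧
  ∀ u : X, ∃ a : X → B,
    (∀ x ∈ R, ∀ y ∈ R, x ≠ y → a x * a y = 0) ∧
    (∀ x ∈ R, a x * m.d u x = 0) ∧ (1 + ∑ x ∈ R, a x) * m.d u z = 0

/-- An embedding of the Boolean metric space `(X, d)` into a `B`-module `M` sending `x₀`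
to `0`, whose image is metrizable with modular metric corresponding to `d`: for all
`x, y` and `b : B`, `b • (g x - g y) = 0` iff `b * d x y = 0` (i.e. the annihilator of
`g x - g y` is the principal ideal generated by `d x y + 1`). -/
structure ModularEmbedding {B X : Type} [BooleanRing B] (m : BooleanMetric B X) (x₀ : X) where
  M : Type
  [grp : AddCommGroup M]
  [mod : Module B M]
  g : X → M
  inj : Function.Injective g
  base : g x₀ = 0
  ann : ∀ x y : X, ∀ b : B, b • (g x - g y) = 0 ↔ b * m.d x y = 0

/-- If `b` annihilates `d x y`, then the distance functions from `x` and from `y`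
agree after multiplication by `b`. -/
theorem BooleanMetric.mul_d_eq_mul_d {B X : Type} [BooleanRing B] (m : BooleanMetric B X)
    {b : B} {x y : X} (h : b * m.d x y = 0) (z : X) : b * m.d x z = b * m.d y z := by
  have h₁ := m.d_tri x y z
  have h₂ := m.d_tri y x z
  rw [m.d_symm y x] at h₂
  unfold ble bjoin at h₁ h₂
  linear_combination b * h₂ - b * h₁ + (m.d x z - m.d y z) * h

/-- Every Boolean metric space over `B` is isometric to a metrizable subset of a
`B`-module, via an isometry sending a prescribed point `x₀` to `0`. -/
theorem stmt2 {B X : Type} [BooleanRing B] (m : BooleanMetric B X) (x₀ : X) :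
    Nonempty (ModularEmbedding m x₀) := by
  have d_self (x : X) : m.d x x = 0 := (m.d_eq_zero x x).2 rfl
  have ann : ∀ x y : X, ∀ b : B,
      b • ((m.d x - m.d x₀) - (m.d y - m.d x₀)) = 0 ↔ b * m.d x y = 0 := by
    intro x y b
    rw [sub_sub_sub_cancel_right]
    refine ⟨fun h => by simpa [d_self] using congrFun h y, fun h => funext fun z => ?_⟩
    simp [mul_sub, m.mul_d_eq_mul_d h z]
  refine ⟨{ M := X → B, g := fun x => m.d x - m.d x₀, inj := fun x y h => ?_,
            base := sub_self _, ann := ann }⟩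
  exact (m.d_eq_zero x y).1 (by simpa using (ann x y 1).1 (by simpa [sub_eq_zero] using h))
end

section
/- Let A be a CFG-ring and let U ⊆ Aⁿ and V ⊆ Aᵐ be algebraic varieties over A. A map f : U → V is a polynomial map if and only if it is contractive, i.e., d(f(x),f(y)) ≤ d(x,y) for all x,y ∈ U, where d denotes the metric d(x,y) = e(x₁−y₁) ∨ ⋯ ∨ e(xₖ−yₖ) on Aᵏ restricted to U and V. -/
/-- The order on idempotents of a commutative ring: `a ≤ b` iff `a * b = a`. -/
def ale {A : Type} [CommRing A] (a b : A) : Prop := a * b = a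

/-- The join `v 0 ∨ v 1 ∨ ⋯ ∨ v (n-1)` of a finite family of idempotents, where
`a ∨ b = a + b - a * b`. -/
def bigSup {A : Type} [CommRing A] : {n : ℕ} → (Fin n → A) → A
  | 0, _ => 0
  | _ + 1, v => v 0 + bigSup (Fin.tail v) - v 0 * bigSup (Fin.tail v)

/-- `A` is a CFG-ring: a commutative von Neumann regular ring having finitely many
elements `x₁, …, xₖ` such that every element of `A` is of the form `∑ aᵢ xᵢ` with
`aᵢ` idempotents having pairwise zero products and summing to `1`. -/
def IsCFGRing (A : Type) [CommRing A] : Prop :=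
  (∀ a : A, ∃ b, a * b * a = a) ∧
  ∃ (k : ℕ) (xs : Fin k → A), ∀ x : A, ∃ a : Fin k → A,
    (∀ i, a i * a i = a i) ∧ (∀ i j, i ≠ j → a i * a j = 0) ∧ (∑ i, a i) = 1 ∧
    x = ∑ i, a i * xs i

/-- `e` assigns to each `a : A` the unique idempotent `e a` with `aA = (e a)A`. -/
def IsIdemGen {A : Type} [CommRing A] (e : A → A) : Prop :=
  ∀ a : A, e a * e a = e a ∧ Ideal.span {a} = Ideal.span {e a}

/-- The Boolean metric on `Aⁿ`: `d x y = e(x₁ - y₁) ∨ ⋯ ∨ e(xₙ - yₙ)`. -/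
def dVec {A : Type} [CommRing A] (e : A → A) {n : ℕ} (x y : Fin n → A) : A :=
  bigSup fun i => e (x i - y i)

/-- `U` is an algebraic variety: the common zero set of finitely many polynomials. -/
def IsAlgebraicVariety {A : Type} [CommRing A] {n : ℕ} (U : Set (Fin n → A)) : Prop :=
  ∃ (k : ℕ) (ps : Fin k → MvPolynomial (Fin n) A),
    U = {x : Fin n → A | ∀ j, MvPolynomial.eval x (ps j) = 0}

/-- A subset `S` of a space with `A`-valued Boolean metric `d` is convex: all convex
combinations (with idempotent coefficients having pairwise zero products and summing
to `1`) of points of `S` exist in `S`. -/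
def IsConvexSubA {A Z : Type} [CommRing A] (d : Z → Z → A) (S : Set Z) : Prop :=
  ∀ (k : ℕ) (a : Fin k → A) (xs : Fin k → Z), (∀ i, xs i ∈ S) →
    (∀ i, a i * a i = a i) → (∀ i j, i ≠ j → a i * a j = 0) → (∑ i, a i) = 1 →
    ∃ x ∈ S, ∀ i, a i * d x (xs i) = 0

/-- `S` is a CFG-space: convex, and finitely many points of `S` have every point of `S`
as a convex combination. -/
def IsCFGSubA {A Z : Type} [CommRing A] (d : Z → Z → A) (S : Set Z) : Prop :=
  IsConvexSubA d S ∧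
  ∃ (k : ℕ) (xs : Fin k → Z), (∀ i, xs i ∈ S) ∧
    ∀ x ∈ S, ∃ a : Fin k → A,
      (∀ i, a i * a i = a i) ∧ (∀ i j, i ≠ j → a i * a j = 0) ∧ (∑ i, a i) = 1 ∧
      ∀ i, a i * d x (xs i) = 0

section Auxiliary

variable {A : Type} [CommRing A]

theorem one_sub_bigSup : ∀ {n : ℕ} (v : Fin n → A), 1 - bigSup v = ∏ i, (1 - v i)
  | 0, _ => by simp [bigSup]
  | n + 1, v => by
    have h := one_sub_bigSup (Fin.tail v)
    rw [Fin.prod_univ_succ, bigSup]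
    simp only [Fin.tail] at h ⊢
    rw [← h]
    ring

theorem mul_prod_one_sub {ι : Type*} (s : Finset ι) (b : A) (z : ι → A)
    (h : ∀ i ∈ s, b * z i = 0) : b * ∏ i ∈ s, (1 - z i) = b := by
  classical
  induction s using Finset.induction_on with
  | empty => simp
  | insert i s hi ih =>
    rw [Finset.prod_insert hi, mul_left_comm, ih fun j hj => h j (Finset.mem_insert_of_mem hj)]
    linear_combination -h i (Finset.mem_insert_self i s)

theorem mul_bigSup_eq_zero {n : ℕ} {b : A} {v : Fin n → A} (h : ∀ i, b * v i = 0) :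
    b * bigSup v = 0 := by
  have h1 := mul_prod_one_sub Finset.univ b v fun i _ => h i
  rw [← one_sub_bigSup] at h1
  linear_combination -h1

theorem mul_prod_eq_zero_of_mem {ι : Type*} {s : Finset ι} {z : ι → A} {a : A} {i : ι}
    (hi : i ∈ s) (h : a * z i = 0) : a * ∏ j ∈ s, z j = 0 := by
  obtain ⟨c, hc⟩ := Finset.dvd_prod_of_mem z hi
  rw [hc, ← mul_assoc, h, zero_mul]

theorem mul_bigSup_of_idem {n : ℕ} {v : Fin n → A} (i : Fin n) (h : v i * v i = v i) :
    v i * bigSup v = v i := by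
  have h1 : v i * ∏ j, (1 - v j) = 0 :=
    mul_prod_eq_zero_of_mem (Finset.mem_univ i) (by linear_combination -h)
  rw [← one_sub_bigSup] at h1
  linear_combination -h1

theorem IsIdemGen.mul_eq_zero_iff {e : A → A} (he : IsIdemGen e) (a b : A) :
    b * e a = 0 ↔ b * a = 0 := by
  have h1 : a ∈ Ideal.span {e a} := (he a).2 ▸ Ideal.mem_span_singleton_self a
  have h2 : e a ∈ Ideal.span {a} := (he a).2 ▸ Ideal.mem_span_singleton_self (e a)
  obtain ⟨c, hc⟩ := Ideal.mem_span_singleton'.1 h1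
  obtain ⟨d, hd⟩ := Ideal.mem_span_singleton'.1 h2
  constructor <;> intro h
  · linear_combination c * h - b * hc
  · linear_combination d * h - b * hd

/-- An element kills `dVec e x y` iff it kills all coordinate differences. -/
theorem IsIdemGen.mul_dVec_eq_zero_iff {e : A → A} (he : IsIdemGen e) {n : ℕ}
    (x y : Fin n → A) (b : A) : b * dVec e x y = 0 ↔ ∀ i, b * (x i - y i) = 0 := by
  refine ⟨fun h i => (he.mul_eq_zero_iff _ _).1 ?_,
    fun h => mul_bigSup_eq_zero fun i => (he.mul_eq_zero_iff _ _).2 (h i)⟩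
  have h1 := mul_bigSup_of_idem (v := fun i => e (x i - y i)) i (he _).1
  change _ * dVec e x y = _ at h1
  linear_combination e (x i - y i) * h - b * h1

theorem mul_eval_sub_eval {σ : Type*} {b : A} {x y : σ → A} (h : ∀ i, b * (x i - y i) = 0)
    (p : MvPolynomial σ A) : b * (MvPolynomial.eval x p - MvPolynomial.eval y p) = 0 := by
  induction p using MvPolynomial.induction_on with
  | C a => simp
  | add p q hp hq =>
    simp only [map_add]
    linear_combination hp + hq
  | mul_X p i hp =>
    simp only [map_mul, MvPolynomial.eval_X]
    linear_combination x i * hp + MvPolynomial.eval y p * h i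

/-- The difference of two points is killed by the complement of their distance. -/
theorem IsIdemGen.one_sub_dVec_mul {e : A → A} (he : IsIdemGen e) {n : ℕ}
    (x y : Fin n → A) (i : Fin n) : (1 - dVec e x y) * (x i - y i) = 0 := by
  refine (he.mul_eq_zero_iff _ _).1 ?_
  have h1 := mul_bigSup_of_idem (v := fun i => e (x i - y i)) i (he _).1
  change _ * dVec e x y = _ at h1
  linear_combination -h1

/-- In a domain covered by the images of `k` elements, nonzero elements have order
dividing `k!`. -/
theorem pow_factorial_eq_one_of_surjective {K : Type*} [CommRing K] [IsDomain K] {k : ℕ}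
    (g : Fin k → K) (hg : Function.Surjective g) {x : K} (hx : x ≠ 0) :
    x ^ k.factorial = 1 := by
  have hK : Finite K := Finite.of_surjective g hg
  obtain ⟨u, hu⟩ := (Finite.isField_of_domain K).mul_inv_cancel hx
  let v : Kˣ := ⟨x, u, hu, by rw [mul_comm, hu]⟩
  have hcard : Nat.card Kˣ ≤ k := calc
    Nat.card Kˣ ≤ Nat.card K := Nat.card_le_card_of_injective _ Units.val_injective
    _ ≤ Nat.card (Fin k) := Nat.card_le_card_of_surjective g hg
    _ = k := Nat.card_fin k
  have hv : v ^ k.factorial = 1 := orderOf_dvd_iff_pow_eq_one.1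
    ((orderOf_dvd_natCard v).trans (Nat.dvd_factorial Nat.card_pos hcard))
  simpa [v] using congrArg Units.val hv

theorem IsCFGRing.exists_pow_succ_eq (hA : IsCFGRing A) :
    ∃ M : ℕ, M ≠ 0 ∧ ∀ a : A, a ^ (M + 1) = a := by
  obtain ⟨hreg, k, xs, hxs⟩ := hA
  refine ⟨k.factorial, k.factorial_ne_zero, fun a => sub_eq_zero.1 ?_⟩
  set z := a ^ (k.factorial + 1) - a with hz
  have hnil : z ∈ nilradical A := by
    rw [nilradical_eq_sInf, Ideal.mem_sInf]
    intro P hP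
    have : P.IsPrime := hP
    let π := Ideal.Quotient.mk P
    have hsurj : Function.Surjective fun i => π (xs i) := by
      intro w
      obtain ⟨x, rfl⟩ := Ideal.Quotient.mk_surjective w
      obtain ⟨c, hc, hdisj, hsum, hx⟩ := hxs x
      obtain ⟨i, hi⟩ : ∃ i, π (c i) ≠ 0 := by
        by_contra! h
        have h1 := congrArg π hsum
        simp [h] at h1
      refine ⟨i, mul_left_cancel₀ hi ?_⟩
      change π (c i) * π (xs i) = π (c i) * π x
      rw [← map_mul, ← map_mul, hx, Finset.mul_sum, Finset.sum_eq_single i]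
      · rw [← mul_assoc, hc]
      · intro j _ hj
        rw [← mul_assoc, hdisj i j hj.symm, zero_mul]
      · simp
    refine Ideal.Quotient.eq_zero_iff_mem.1 ?_
    change π z = 0
    by_cases ha : π a = 0
    · simp [hz, ha]
    · simp [hz, pow_succ, pow_factorial_eq_one_of_surjective _ hsurj ha]
  obtain ⟨N, hN⟩ := mem_nilradical.1 hnil
  obtain ⟨b, hb⟩ := hreg z
  have hpow : ∀ j : ℕ, z = (z * b) ^ j * z := by
    intro j
    induction j with
    | zero => simp
    | succ j ih => rw [pow_succ, mul_assoc, hb, ← ih]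
  rw [hpow N, mul_pow, hN, zero_mul, zero_mul]

/-- Every point of `Aⁿ` is a convex combination of the points of a finite grid. -/
theorem IsCFGRing.exists_grid (hA : IsCFGRing A) (n : ℕ) :
    ∃ (ι : Type) (_ : Fintype ι) (g : ι → Fin n → A), ∀ x : Fin n → A, ∃ a : ι → A,
      ∑ i, a i = 1 ∧ ∀ i t, a i * (x t - g i t) = 0 := by
  obtain ⟨-, k, xs, hxs⟩ := hA
  refine ⟨Fin n → Fin k, inferInstance, fun h t => xs (h t), fun x => ?_⟩
  choose c hc hdisj hsum hx using fun t => hxs (x t)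
  refine ⟨fun h => ∏ t, c t (h t), ?_, fun h t => ?_⟩
  · rw [← Fintype.prod_sum]
    simp [hsum]
  · rw [mul_comm]
    refine mul_prod_eq_zero_of_mem (Finset.mem_univ t) ?_
    have h1 : c t (h t) * x t = c t (h t) * xs (h t) := by
      conv_lhs => rw [hx t]
      rw [Finset.mul_sum, Finset.sum_eq_single (h t)]
      · rw [← mul_assoc, hc]
      · intro j _ hj
        rw [← mul_assoc, hdisj t _ j hj.symm, zero_mul]
      · simp
    linear_combination h1

/-- A nonempty algebraic variety over a CFG-ring is generated by finitely many of its points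
under convex combinations. -/
theorem IsCFGRing.exists_generators (hA : IsCFGRing A) {n : ℕ} {U : Set (Fin n → A)}
    (hU : IsAlgebraicVariety U) (hne : U.Nonempty) :
    ∃ (ι : Type) (_ : Fintype ι) (u : ι → Fin n → A), (∀ i, u i ∈ U) ∧
      ∀ x ∈ U, ∃ a : ι → A, ∑ i, a i = 1 ∧ ∀ i t, a i * (x t - u i t) = 0 := by
  obtain ⟨M, hM0, hM⟩ := hA.exists_pow_succ_eq
  obtain ⟨ι, hι, g, hg⟩ := hA.exists_grid n
  obtain ⟨k, ps, rfl⟩ := hU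
  obtain ⟨u₀, hu₀⟩ := hne
  let z : ι → Fin k → A := fun i j => MvPolynomial.eval (g i) (ps j)
  let c : ι → A := fun i => ∏ j, (1 - z i j ^ M)
  have hcz : ∀ i j, c i * z i j = 0 := fun i j => by
    rw [mul_comm]
    exact mul_prod_eq_zero_of_mem (Finset.mem_univ j) (by linear_combination -hM (z i j))
  have hcidem : ∀ i, c i * c i = c i := fun i =>
    mul_prod_one_sub Finset.univ (c i) _ fun j _ => by
      obtain ⟨N, rfl⟩ := Nat.exists_eq_succ_of_ne_zero hM0
      rw [pow_succ', ← mul_assoc, hcz, zero_mul]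
  refine ⟨ι, hι, fun i t => c i * g i t + (1 - c i) * u₀ t, fun i j => ?_, fun x hx => ?_⟩
  · have h1 := mul_eval_sub_eval (b := c i) (x := fun t => c i * g i t + (1 - c i) * u₀ t)
      (y := g i) (fun t => by linear_combination (g i t - u₀ t) * hcidem i) (ps j)
    have h2 := mul_eval_sub_eval (b := 1 - c i)
      (x := fun t => c i * g i t + (1 - c i) * u₀ t) (y := u₀)
      (fun t => by linear_combination (u₀ t - g i t) * hcidem i) (ps j)
    linear_combination h1 + h2 + hcz i j + (1 - c i) * hu₀ j
  · obtain ⟨a, hsum, ha⟩ := hg x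
    refine ⟨a, hsum, fun i t => ?_⟩
    have hac : a i * c i = a i := mul_prod_one_sub Finset.univ (a i) _ fun j _ => by
      have h1 := mul_eval_sub_eval (ha i) (ps j)
      rw [hx j, zero_sub, mul_neg, neg_eq_zero] at h1
      obtain ⟨N, rfl⟩ := Nat.exists_eq_succ_of_ne_zero hM0
      rw [pow_succ', ← mul_assoc, h1, zero_mul]
    linear_combination ha i t - (g i t - u₀ t) * hac

/-- A function which agrees with its value at `u i` wherever `b i` does not vanish is given by
a polynomial, up to the product of the complements of the `b i`. -/
theorem exists_interpolation {σ ι : Type*} (U : Set (σ → A)) (φ : (σ → A) → A)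
    (u : ι → σ → A) (b : ι → MvPolynomial σ A)
    (h : ∀ i, ∀ x ∈ U, MvPolynomial.eval x (b i) * (φ x - φ (u i)) = 0) (s : Finset ι) :
    ∃ p : MvPolynomial σ A, ∀ x ∈ U, φ x - MvPolynomial.eval x p =
      (φ x) * ∏ i ∈ s, (1 - MvPolynomial.eval x (b i)) := by
  classical
  induction s using Finset.induction_on with
  | empty => exact ⟨0, by simp⟩
  | insert i s hi ih =>
    obtain ⟨p, hp⟩ := ih
    refine ⟨p + (MvPolynomial.C (φ (u i)) - p) * b i, fun x hx => ?_⟩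
    rw [Finset.prod_insert hi]
    simp only [map_add, map_mul, map_sub, MvPolynomial.eval_C]
    linear_combination (1 - MvPolynomial.eval x (b i)) * hp x hx + h i x hx

end Auxiliary

/-- Over a CFG-ring `A`, a map between algebraic varieties `U ⊆ Aⁿ` and `V ⊆ Aᵐ` is a
polynomial map iff it is contractive. -/
theorem stmt16 {A : Type} [CommRing A] (hA : IsCFGRing A)
    (e : A → A) (he : IsIdemGen e)
    {n m : ℕ} (U : Set (Fin n → A)) (V : Set (Fin m → A))
    (hU : IsAlgebraicVariety U) (hV : IsAlgebraicVariety V)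
    (f : (Fin n → A) → (Fin m → A)) (hmap : ∀ x ∈ U, f x ∈ V) :
    (∃ p : Fin m → MvPolynomial (Fin n) A,
      ∀ x ∈ U, f x = fun j => MvPolynomial.eval x (p j)) ↔
    ∀ x ∈ U, ∀ y ∈ U, ale (dVec e (f x) (f y)) (dVec e x y) := by
  constructor
  · rintro ⟨p, hp⟩ x hx y hy
    have h : (1 - dVec e x y) * dVec e (f x) (f y) = 0 :=
      (he.mul_dVec_eq_zero_iff _ _ _).2 fun j => by
        rw [hp x hx, hp y hy]
        exact mul_eval_sub_eval (he.one_sub_dVec_mul x y) (p j)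
    unfold ale
    linear_combination -h
  · intro hf
    rcases U.eq_empty_or_nonempty with rfl | hne
    · exact ⟨0, fun x hx => hx.elim⟩
    obtain ⟨M, hM0, hM⟩ := hA.exists_pow_succ_eq
    obtain ⟨ι, _, u, hu, hgen⟩ := hA.exists_generators hU hne
    let b : ι → MvPolynomial (Fin n) A := fun i =>
      ∏ t, (1 - (MvPolynomial.X t - MvPolynomial.C (u i t)) ^ M)
    have hb : ∀ i x, MvPolynomial.eval x (b i) = ∏ t, (1 - (x t - u i t) ^ M) := fun i x => by
      simp [b, map_prod]
    have key : ∀ i, ∀ x ∈ U, ∀ j,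
        MvPolynomial.eval x (b i) * (f x j - f (u i) j) = 0 := fun i x hx => by
      have h1 : MvPolynomial.eval x (b i) * dVec e x (u i) = 0 :=
        (he.mul_dVec_eq_zero_iff _ _ _).2 fun t => by
          rw [hb, mul_comm]
          exact mul_prod_eq_zero_of_mem (Finset.mem_univ t)
            (by linear_combination -hM (x t - u i t))
      have h2 : _ * _ = _ := hf x hx (u i) (hu i)
      exact (he.mul_dVec_eq_zero_iff _ _ _).1 (by
        rw [← h2, mul_left_comm, h1, mul_zero])
    choose p hp using fun j => exists_interpolation U (fun x => f x j) u b
      (fun i x hx => key i x hx j) Finset.univ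
    refine ⟨p, fun x hx => funext fun j => sub_eq_zero.1 ((hp j x hx).trans ?_)⟩
    obtain ⟨a, hsum, ha⟩ := hgen x hx
    have hzero : ∏ i, (1 - MvPolynomial.eval x (b i)) = 0 := by
      refine (one_mul _).symm.trans ?_
      rw [(congrArg (· * _) hsum.symm : 1 * _ = (∑ i, a i) * _), Finset.sum_mul]
      refine Finset.sum_eq_zero fun i _ => mul_prod_eq_zero_of_mem (Finset.mem_univ i) ?_
      have h1 := mul_prod_one_sub Finset.univ (a i) (fun t => (x t - u i t) ^ M) fun t _ => by
        obtain ⟨N, rfl⟩ := Nat.exists_eq_succ_of_ne_zero hM0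
        rw [pow_succ', ← mul_assoc, ha, zero_mul]
      rw [hb]
      linear_combination -h1
    rw [hzero, mul_zero]
end
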